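/- arXiv:2112.04617 — 4 statements merged into one kernel-verified Lean document; each statement's English description precedes it below -/
import Mathlib

section
/- Let n, N be positive integers, let (d_{ij}) be an n×N matrix of nonnegative reals such that every column contains a nonzero entry, and let z ∈ ℂ⁺. Then there exist e_1^0, …, e_N^0 ∈ ℂ⁺ satisfying the system e_j^0 = (1/n) Σ_{i=1}^n d_{ij}² / [ (1/N) Σ_{k=1}^N d_{ik}²/(1 + (n/N)e_k^0) − z ] for j = 1, …, N. -/
/-!
The system is solved in the variables `f i = -1 / (z + ∑ k, w i k * a k)`, where
`a k = -1 / (1 + ∑ i, w i k * f i)`. The resulting self-map strictly decreases the hyperbolic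
pseudo-distance `‖u - v‖ ^ 2 / (u.im * v.im)` and maps `{f | 0 < f.im, 0 ≤ (z * f).im}` into a
compact subset of itself, so the displacement attains its minimum, which must vanish.
-/

theorem Complex.im_neg_inv (u : ℂ) : (-u⁻¹).im = u.im / ‖u‖ ^ 2 := by
  rw [Complex.neg_im, Complex.inv_im, Complex.normSq_eq_norm_sq]
  ring

theorem Complex.ne_zero_of_im_pos {u : ℂ} (hu : 0 < u.im) : u ≠ 0 := by
  rintro rfl
  simp at hu

theorem Complex.im_neg_inv_pos {u : ℂ} (hu : 0 < u.im) : 0 < (-u⁻¹).im := by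
  have := Complex.ne_zero_of_im_pos hu
  rw [Complex.im_neg_inv]
  positivity

theorem Complex.im_sum_ofReal_mul {ι : Type*} [Fintype ι] (w : ι → ℝ) (u : ι → ℂ) :
    (∑ i, (w i : ℂ) * u i).im = ∑ i, w i * (u i).im := by
  simp [Complex.im_sum]

/-- The map `u ↦ -1 / u` preserves the hyperbolic pseudo-distance. -/
theorem norm_sq_neg_inv_sub_neg_inv {u v : ℂ} (hu : u ≠ 0) (hv : v ≠ 0) :
    ‖-u⁻¹ - -v⁻¹‖ ^ 2 = ‖u - v‖ ^ 2 / (‖u‖ ^ 2 * ‖v‖ ^ 2) := by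
  have : -u⁻¹ - -v⁻¹ = (u - v) / (u * v) := by field_simp; ring
  rw [this, norm_div, norm_mul, div_pow, mul_pow]

theorem norm_sq_neg_inv_sub_neg_inv_le {r : ℝ} {u v : ℂ} (hu : u ≠ 0) (hv : v ≠ 0)
    (h : ‖u - v‖ ^ 2 ≤ r * (u.im * v.im)) :
    ‖-u⁻¹ - -v⁻¹‖ ^ 2 ≤ r * ((-u⁻¹).im * (-v⁻¹).im) := by
  rw [norm_sq_neg_inv_sub_neg_inv hu hv, Complex.im_neg_inv, Complex.im_neg_inv,
    div_mul_div_comm, ← mul_div_assoc]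
  gcongr

theorem norm_sq_neg_inv_sub_neg_inv_lt {r : ℝ} {u v : ℂ} (hu : u ≠ 0) (hv : v ≠ 0)
    (h : ‖u - v‖ ^ 2 < r * (u.im * v.im)) :
    ‖-u⁻¹ - -v⁻¹‖ ^ 2 < r * ((-u⁻¹).im * (-v⁻¹).im) := by
  rw [norm_sq_neg_inv_sub_neg_inv hu hv, Complex.im_neg_inv, Complex.im_neg_inv,
    div_mul_div_comm, ← mul_div_assoc]
  gcongr

/-- Nonnegative combinations do not increase the hyperbolic pseudo-distance. -/
theorem norm_sq_sum_sub_sum_le {ι : Type*} [Fintype ι] {w : ι → ℝ} (hw : ∀ i, 0 ≤ w i)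
    {r : ℝ} (hr : 0 ≤ r) {u v : ι → ℂ} (hu : ∀ i, 0 ≤ (u i).im) (hv : ∀ i, 0 ≤ (v i).im)
    (h : ∀ i, ‖u i - v i‖ ^ 2 ≤ r * ((u i).im * (v i).im)) :
    ‖∑ i, (w i : ℂ) * u i - ∑ i, (w i : ℂ) * v i‖ ^ 2 ≤
      r * ((∑ i, (w i : ℂ) * u i).im * (∑ i, (w i : ℂ) * v i).im) := by
  have hnorm : ‖∑ i, (w i : ℂ) * u i - ∑ i, (w i : ℂ) * v i‖ ≤ ∑ i, w i * ‖u i - v i‖ := by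
    rw [← Finset.sum_sub_distrib]
    refine (norm_sum_le _ _).trans_eq (Finset.sum_congr rfl fun i _ ↦ ?_)
    rw [← mul_sub, norm_mul, Complex.norm_of_nonneg (hw i)]
  have hcs : (∑ i, w i * ‖u i - v i‖) ^ 2 ≤
      (∑ i, r * (w i * (u i).im)) * ∑ i, w i * (v i).im := by
    refine Finset.sum_sq_le_sum_mul_sum_of_sq_le_mul _
      (fun i _ ↦ mul_nonneg hr (mul_nonneg (hw i) (hu i)))
      (fun i _ ↦ mul_nonneg (hw i) (hv i)) fun i _ ↦ ?_
    calc (w i * ‖u i - v i‖) ^ 2 = w i ^ 2 * ‖u i - v i‖ ^ 2 := by ring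
      _ ≤ w i ^ 2 * (r * ((u i).im * (v i).im)) := by gcongr; exact h i
      _ = r * (w i * (u i).im) * (w i * (v i).im) := by ring
  rw [Complex.im_sum_ofReal_mul, Complex.im_sum_ofReal_mul, ← mul_assoc,
    Finset.mul_sum (a := r)]
  exact (pow_le_pow_left₀ (norm_nonneg _) hnorm 2).trans hcs

section

variable {ι κ : Type*} [Fintype ι] {w : ι → κ → ℝ} {z : ℂ} {f g : ι → ℂ}

/-- The quantities `a k = -1 / (1 + ∑ i, w i k * f i)`. -/
noncomputable def colMap (w : ι → κ → ℝ) (f : ι → ℂ) (k : κ) : ℂ :=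
  -(1 + ∑ i, (w i k : ℂ) * f i)⁻¹

theorem im_one_add_sum_pos (hw : ∀ i k, 0 ≤ w i k) (hcol : ∀ k, ∃ i, 0 < w i k)
    (hf : ∀ i, 0 < (f i).im) (k : κ) : 0 < (1 + ∑ i, (w i k : ℂ) * f i).im := by
  rw [Complex.add_im, Complex.im_sum_ofReal_mul, Complex.one_im, zero_add]
  obtain ⟨i, hi⟩ := hcol k
  exact Finset.sum_pos' (fun i _ ↦ mul_nonneg (hw i k) (hf i).le)
    ⟨i, Finset.mem_univ i, mul_pos hi (hf i)⟩

theorem im_colMap_pos (hw : ∀ i k, 0 ≤ w i k) (hcol : ∀ k, ∃ i, 0 < w i k)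
    (hf : ∀ i, 0 < (f i).im) (k : κ) : 0 < (colMap w f k).im :=
  Complex.im_neg_inv_pos (im_one_add_sum_pos hw hcol hf k)

theorem norm_colMap_le (hw : ∀ i k, 0 ≤ w i k) (hz : 0 < z.im)
    (hzf : ∀ i, 0 ≤ (z * f i).im) (k : κ) : ‖colMap w f k‖ ≤ ‖z‖ / z.im := by
  have him : z.im ≤ (z * (1 + ∑ i, (w i k : ℂ) * f i)).im := by
    rw [mul_add, mul_one, Finset.mul_sum, Complex.add_im]
    simp_rw [mul_left_comm z]
    rw [Complex.im_sum_ofReal_mul]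
    exact le_add_of_nonneg_right (Finset.sum_nonneg fun i _ ↦ mul_nonneg (hw i k) (hzf i))
  have hle := him.trans ((Complex.abs_im_le_norm _).trans' (le_abs_self _))
  rw [norm_mul] at hle
  have ht : 0 < ‖1 + ∑ i, (w i k : ℂ) * f i‖ :=
    pos_of_mul_pos_right (hz.trans_le hle) (norm_nonneg z)
  rw [colMap, norm_neg, norm_inv, le_div_iff₀ hz, inv_mul_le_iff₀ ht]
  linarith

variable [Fintype κ]

/-- The self-map of `ι → ℂ` whose fixed points solve the system. -/
noncomputable def rowMap (w : ι → κ → ℝ) (z : ℂ) (f : ι → ℂ) (i : ι) : ℂ :=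
  -(z + ∑ k, (w i k : ℂ) * colMap w f k)⁻¹

theorem le_im_add_sum_colMap (hw : ∀ i k, 0 ≤ w i k) (hcol : ∀ k, ∃ i, 0 < w i k)
    (hf : ∀ i, 0 < (f i).im) (i : ι) :
    z.im ≤ (z + ∑ k, (w i k : ℂ) * colMap w f k).im := by
  rw [Complex.add_im, Complex.im_sum_ofReal_mul]
  exact le_add_of_nonneg_right
    (Finset.sum_nonneg fun k _ ↦ mul_nonneg (hw i k) (im_colMap_pos hw hcol hf k).le)

/-- `rowMap` strictly decreases the hyperbolic pseudo-distance. -/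
theorem norm_sq_rowMap_sub_lt (hw : ∀ i k, 0 ≤ w i k) (hcol : ∀ k, ∃ i, 0 < w i k)
    (hz : 0 < z.im) (hf : ∀ i, 0 < (f i).im) (hg : ∀ i, 0 < (g i).im) {r : ℝ} (hr : 0 < r)
    (h : ∀ i, ‖f i - g i‖ ^ 2 ≤ r * ((f i).im * (g i).im)) (i : ι) :
    ‖rowMap w z f i - rowMap w z g i‖ ^ 2 <
      r * ((rowMap w z f i).im * (rowMap w z g i).im) := by
  have hcolMap (k : κ) : ‖colMap w f k - colMap w g k‖ ^ 2 ≤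
      r * ((colMap w f k).im * (colMap w g k).im) := by
    refine norm_sq_neg_inv_sub_neg_inv_le
      (Complex.ne_zero_of_im_pos (im_one_add_sum_pos hw hcol hf k))
      (Complex.ne_zero_of_im_pos (im_one_add_sum_pos hw hcol hg k)) ?_
    simpa using norm_sq_sum_sub_sum_le (fun i ↦ hw i k) hr.le (fun i ↦ (hf i).le)
      (fun i ↦ (hg i).le) h
  have hsum := norm_sq_sum_sub_sum_le (hw i) hr.le
    (fun k ↦ (im_colMap_pos hw hcol hf k).le) (fun k ↦ (im_colMap_pos hw hcol hg k).le) hcolMap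
  have hf' := le_im_add_sum_colMap (z := z) hw hcol hf i
  have hg' := le_im_add_sum_colMap (z := z) hw hcol hg i
  refine norm_sq_neg_inv_sub_neg_inv_lt (Complex.ne_zero_of_im_pos (hz.trans_le hf'))
    (Complex.ne_zero_of_im_pos (hz.trans_le hg')) ?_
  rw [add_sub_add_left_eq_sub]
  refine hsum.trans_lt (mul_lt_mul_of_pos_left ?_ hr)
  rw [Complex.add_im] at hf' hg' ⊢
  rw [Complex.add_im]
  nlinarith

theorem norm_rowMap_le (hw : ∀ i k, 0 ≤ w i k) (hcol : ∀ k, ∃ i, 0 < w i k)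
    (hz : 0 < z.im) (hf : ∀ i, 0 < (f i).im) (i : ι) : ‖rowMap w z f i‖ ≤ z.im⁻¹ := by
  rw [rowMap, norm_neg, norm_inv]
  gcongr
  exact (le_im_add_sum_colMap hw hcol hf i).trans
    ((Complex.abs_im_le_norm _).trans' (le_abs_self _))

theorem le_im_rowMap (hw : ∀ i k, 0 ≤ w i k) (hcol : ∀ k, ∃ i, 0 < w i k)
    (hz : 0 < z.im) (hf : ∀ i, 0 < (f i).im) (hzf : ∀ i, 0 ≤ (z * f i).im) (i : ι) :
    z.im / (‖z‖ + (∑ i, ∑ k, w i k) * (‖z‖ / z.im)) ^ 2 ≤ (rowMap w z f i).im := by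
  have hs := le_im_add_sum_colMap (z := z) hw hcol hf i
  have hs0 := norm_pos_iff.2 (Complex.ne_zero_of_im_pos (hz.trans_le hs))
  rw [rowMap, Complex.im_neg_inv]
  refine div_le_div₀ (hz.le.trans hs) hs (by positivity)
    (pow_le_pow_left₀ (norm_nonneg _) (norm_add_le_of_le le_rfl ?_) 2)
  calc ‖∑ k, (w i k : ℂ) * colMap w f k‖ ≤ ∑ k, w i k * (‖z‖ / z.im) := by
        refine norm_sum_le_of_le _ fun k _ ↦ ?_
        rw [norm_mul, Complex.norm_of_nonneg (hw i k)]
        exact mul_le_mul_of_nonneg_left (norm_colMap_le hw hz hzf k) (hw i k)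
    _ = (∑ k, w i k) * (‖z‖ / z.im) := by rw [Finset.sum_mul]
    _ ≤ (∑ i, ∑ k, w i k) * (‖z‖ / z.im) := by
        gcongr
        exact Finset.single_le_sum (f := fun i ↦ ∑ k, w i k)
          (fun i _ ↦ Finset.sum_nonneg fun k _ ↦ hw i k) (Finset.mem_univ i)

theorem im_mul_rowMap_nonneg (hw : ∀ i k, 0 ≤ w i k) (hz : 0 < z.im)
    (hzf : ∀ i, 0 ≤ (z * f i).im) (i : ι) : 0 ≤ (z * rowMap w z f i).im := by
  have hz0 := Complex.ne_zero_of_im_pos hz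
  have hcolMap (k : κ) : 0 ≤ (z⁻¹ * colMap w f k).im := by
    have : z⁻¹ * colMap w f k = -(z * (1 + ∑ i, (w i k : ℂ) * f i))⁻¹ := by
      rw [colMap, mul_inv]; ring
    rw [this, Complex.im_neg_inv, mul_add, mul_one, Finset.mul_sum]
    simp_rw [mul_left_comm z]
    refine div_nonneg ?_ (by positivity)
    rw [Complex.add_im, Complex.im_sum_ofReal_mul]
    exact add_nonneg hz.le (Finset.sum_nonneg fun i _ ↦ mul_nonneg (hw i k) (hzf i))
  have : z * rowMap w z f i = -(z⁻¹ * (z + ∑ k, (w i k : ℂ) * colMap w f k))⁻¹ := by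
    rw [rowMap, mul_inv, inv_inv]; ring
  rw [this, Complex.im_neg_inv, mul_add, inv_mul_cancel₀ hz0, Finset.mul_sum]
  simp_rw [mul_left_comm z⁻¹]
  refine div_nonneg ?_ (by positivity)
  rw [Complex.add_im, Complex.im_sum_ofReal_mul, Complex.one_im, zero_add]
  exact Finset.sum_nonneg fun k _ ↦ mul_nonneg (hw i k) (hcolMap k)

theorem continuousOn_rowMap (hw : ∀ i k, 0 ≤ w i k) (hcol : ∀ k, ∃ i, 0 < w i k)
    (hz : 0 < z.im) (i : ι) :
    ContinuousOn (fun f ↦ rowMap w z f i) {f | ∀ i, 0 < (f i).im} := by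
  refine (ContinuousOn.inv₀ (continuousOn_const.add (continuousOn_finsetSum _ fun k _ ↦
    continuousOn_const.mul (ContinuousOn.inv₀ (by fun_prop) fun f hf ↦ ?_).neg))
    fun f hf ↦ ?_).neg
  · exact Complex.ne_zero_of_im_pos (im_one_add_sum_pos hw hcol hf k)
  · exact Complex.ne_zero_of_im_pos (hz.trans_le (le_im_add_sum_colMap hw hcol hf i))

theorem exists_rowMap_eq_self [Nonempty ι] (hw : ∀ i k, 0 ≤ w i k)
    (hcol : ∀ k, ∃ i, 0 < w i k) (hz : 0 < z.im) :
    ∃ f : ι → ℂ, (∀ i, 0 < (f i).im) ∧ rowMap w z f = f := by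
  have hz0 := Complex.ne_zero_of_im_pos hz
  set δ : ℝ := z.im / (‖z‖ + (∑ i, ∑ k, w i k) * (‖z‖ / z.im)) ^ 2
  have hδ : 0 < δ := by
    have hW : 0 ≤ ∑ i, ∑ k, w i k := Finset.sum_nonneg fun i _ ↦ Finset.sum_nonneg fun k _ ↦ hw i k
    have := norm_pos_iff.2 hz0
    positivity
  set K : Set (ι → ℂ) := Set.univ.pi fun _ ↦
    Metric.closedBall 0 z.im⁻¹ ∩ {u | δ ≤ u.im ∧ 0 ≤ (z * u).im}
  have hK : IsCompact K := by
    refine isCompact_univ_pi fun _ ↦ (isCompact_closedBall _ _).inter_right ?_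
    exact (isClosed_le continuous_const Complex.continuous_im).inter
      (isClosed_le continuous_const
        (Complex.continuous_im.comp (continuous_const.mul continuous_id)))
  have hmaps (f : ι → ℂ) (hf : ∀ i, 0 < (f i).im) (hzf : ∀ i, 0 ≤ (z * f i).im) :
      rowMap w z f ∈ K := fun i _ ↦
    ⟨by simpa using norm_rowMap_le hw hcol hz hf i, le_im_rowMap hw hcol hz hf hzf i,
      im_mul_rowMap_nonneg hw hz hzf i⟩
  have hKpos {f : ι → ℂ} (hf : f ∈ K) (i : ι) : 0 < (f i).im :=
    hδ.trans_le (hf i (Set.mem_univ i)).2.1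
  have hKmaps {f : ι → ℂ} (hf : f ∈ K) : rowMap w z f ∈ K :=
    hmaps f (hKpos hf) fun i ↦ (hf i (Set.mem_univ i)).2.2
  have hKne : K.Nonempty := ⟨_, hmaps (fun _ ↦ -z⁻¹) (fun _ ↦ Complex.im_neg_inv_pos hz)
    fun _ ↦ by simp [hz0]⟩
  let p (f : ι → ℂ) (i : ι) : ℝ :=
    ‖f i - rowMap w z f i‖ ^ 2 / ((f i).im * (rowMap w z f i).im)
  let φ (f : ι → ℂ) : ℝ := Finset.univ.sup' Finset.univ_nonempty (p f)
  have hφ : ContinuousOn φ K := by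
    refine ContinuousOn.finset_sup'_apply _ fun i _ ↦ ?_
    have hrow : ContinuousOn (fun f ↦ rowMap w z f i) K :=
      (continuousOn_rowMap hw hcol hz i).mono fun f hf ↦ hKpos hf
    have happ : ContinuousOn (fun f : ι → ℂ ↦ f i) K := by fun_prop
    exact ((happ.sub hrow).norm.pow 2).div
      ((Complex.continuous_im.comp_continuousOn happ).mul
        (Complex.continuous_im.comp_continuousOn hrow))
      fun f hf ↦ (mul_pos (hKpos hf i) (hKpos (hKmaps hf) i)).ne'
  obtain ⟨f, hfK, hmin⟩ := hK.exists_isMinOn hKne hφ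
  have hf := hKpos hfK
  have hg := hKpos (hKmaps hfK)
  have hp (i : ι) : p f i ≤ φ f := Finset.le_sup' (p f) (Finset.mem_univ i)
  refine ⟨f, hf, ?_⟩
  by_contra hne
  obtain ⟨i, hi⟩ := Function.ne_iff.1 hne
  have hr : 0 < φ f := by
    refine lt_of_lt_of_le ?_ (hp i)
    have := norm_pos_iff.2 (sub_ne_zero.2 (Ne.symm hi))
    have := hf i
    have := hg i
    simp only [p]
    positivity
  have hlt : φ (rowMap w z f) < φ f := by
    refine (Finset.sup'_lt_iff _).2 fun i _ ↦ ?_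
    rw [div_lt_iff₀ (mul_pos (hg i) (hKpos (hKmaps (hKmaps hfK)) i))]
    exact norm_sq_rowMap_sub_lt hw hcol hz hf hg hr
      (fun i ↦ (div_le_iff₀ (mul_pos (hf i) (hg i))).1 (hp i)) i
  exact (hmin (hKmaps hfK)).not_gt hlt

end

/-- Existence of a solution `(e_1⁰, …, e_N⁰) ∈ (ℂ⁺)^N` of the system
`e_j⁰ = (1/n) Σ_i d_{ij}² / [ (1/N) Σ_k d_{ik}²/(1 + (n/N) e_k⁰) − z ]`. -/
theorem exists_solution_of_system
    (n N : ℕ) (hn : 0 < n) (hN : 0 < N)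
    (d : Matrix (Fin n) (Fin N) ℝ) (hd : ∀ i j, 0 ≤ d i j)
    (hcol : ∀ j, ∃ i, d i j ≠ 0)
    (z : ℂ) (hz : 0 < z.im) :
    ∃ e : Fin N → ℂ, ∀ j, 0 < (e j).im ∧
      e j = (n : ℂ)⁻¹ * ∑ i : Fin n, ((d i j : ℂ)) ^ 2 /
        ((N : ℂ)⁻¹ * (∑ k : Fin N, ((d i k : ℂ)) ^ 2 / (1 + ((n : ℂ) / (N : ℂ)) * e k)) - z) := by
  have : NeZero n := ⟨hn.ne'⟩
  have hn0 : (n : ℂ) ≠ 0 := Nat.cast_ne_zero.2 hn.ne'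
  obtain ⟨f, hf, hfix⟩ := exists_rowMap_eq_self (w := fun i k ↦ (N : ℝ)⁻¹ * d i k ^ 2)
    (fun i k ↦ by positivity)
    (fun k ↦ (hcol k).imp fun i hi ↦ by positivity) hz
  refine ⟨fun j ↦ (n : ℂ)⁻¹ * ∑ i, (d i j : ℂ) ^ 2 * f i, fun j ↦ ⟨?_, ?_⟩⟩
  · obtain ⟨i, hi⟩ := hcol j
    have hsum : 0 < (∑ i, ((d i j ^ 2 : ℝ) : ℂ) * f i).im := by
      rw [Complex.im_sum_ofReal_mul]
      exact Finset.sum_pos' (fun i _ ↦ mul_nonneg (sq_nonneg _) (hf i).le)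
        ⟨i, Finset.mem_univ i, mul_pos (by positivity) (hf i)⟩
    have hcast : (n : ℂ)⁻¹ = (((n : ℝ)⁻¹ : ℝ) : ℂ) := by push_cast; rfl
    simp only [hcast, Complex.im_ofReal_mul]
    push_cast at hsum
    positivity
  · have hden (k : Fin N) : (n : ℂ) / N * ((n : ℂ)⁻¹ * ∑ i, (d i k : ℂ) ^ 2 * f i) =
        ∑ i, (((N : ℝ)⁻¹ * d i k ^ 2 : ℝ) : ℂ) * f i := by
      rw [div_eq_mul_inv, mul_comm (n : ℂ), mul_assoc, mul_inv_cancel_left₀ hn0, Finset.mul_sum]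
      refine Finset.sum_congr rfl fun i _ ↦ ?_
      push_cast
      ring
    simp only [hden]
    congr 1
    refine Finset.sum_congr rfl fun i _ ↦ ?_
    rw [div_eq_mul_inv]
    congr 1
    conv_lhs => rw [← hfix]
    rw [rowMap, ← inv_neg, neg_add, Finset.mul_sum, ← Finset.sum_neg_distrib, neg_add_eq_sub]
    congr 2
    refine Finset.sum_congr rfl fun k _ ↦ ?_
    rw [colMap]
    push_cast
    ring
end

section
/- Let n, N be positive integers, let (d_{ij}) be an n×N matrix of nonnegative reals such that every column contains a nonzero entry, and let z ∈ ℂ⁺. If (e_1^0, …, e_N^0) and (ē_1^0, …, ē_N^0) are two N-tuples of elements of ℂ⁺, each satisfying the system e_j = (1/n) Σ_{i=1}^n d_{ij}² / [ (1/N) Σ_{k=1}^N d_{ik}²/(1 + (n/N)e_k) − z ] for j = 1, …, N, then e_j^0 = ē_j^0 for all j. -/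
open Finset in
/-- A weighted Cauchy–Schwarz bound for sums of quotients of complex numbers. -/
theorem norm_sum_mul_div_le {ι : Type*} [Fintype ι] {w a b : ι → ℝ} {p q δ : ι → ℂ} {M : ℝ}
    (hM : 0 ≤ M) (hw : ∀ i, 0 ≤ w i) (ha : ∀ i, 0 ≤ a i) (hb : ∀ i, 0 ≤ b i)
    (hδ : ∀ i, ‖δ i‖ ≤ M * (√(a i) * √(b i))) :
    ‖∑ i, (w i : ℂ) * (δ i / (p i * q i))‖ ≤
      M * (√(∑ i, w i * (a i / ‖p i‖ ^ 2)) * √(∑ i, w i * (b i / ‖q i‖ ^ 2))) := by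
  have hterm : ∀ i, ‖(w i : ℂ) * (δ i / (p i * q i))‖ ≤
      M * (√(w i * (a i / ‖p i‖ ^ 2)) * √(w i * (b i / ‖q i‖ ^ 2))) := by
    intro i
    rw [norm_mul, norm_div, norm_mul, Complex.norm_real, Real.norm_of_nonneg (hw i),
      Real.sqrt_mul (hw i), Real.sqrt_mul (hw i), Real.sqrt_div (ha i), Real.sqrt_div (hb i),
      Real.sqrt_sq (norm_nonneg _), Real.sqrt_sq (norm_nonneg _)]
    calc w i * (‖δ i‖ / (‖p i‖ * ‖q i‖))
        ≤ w i * (M * (√(a i) * √(b i)) / (‖p i‖ * ‖q i‖)) := by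
          have := hw i
          have := hδ i
          gcongr
      _ = √(w i) * √(w i) * (M * (√(a i) * √(b i)) / (‖p i‖ * ‖q i‖)) := by
          rw [Real.mul_self_sqrt (hw i)]
      _ = _ := by ring
  refine (norm_sum_le _ _).trans ((sum_le_sum fun i _ => hterm i).trans ?_)
  rw [← mul_sum]
  refine mul_le_mul_of_nonneg_left (Real.sum_sqrt_mul_sqrt_le _ (fun i => ?_) fun i => ?_) hM
  · have := hw i
    have := ha i
    positivity
  · have := hw i
    have := hb i
    positivity

theorem im_ofReal_mul_inv (r : ℝ) (p : ℂ) : ((r : ℂ) * p⁻¹).im = r * (-p.im / ‖p‖ ^ 2) := by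
  rw [Complex.im_ofReal_mul, Complex.inv_im, Complex.normSq_eq_norm_sq]

/-- The imaginary part of a sum `∑ k, u k / (1 + c e k)`, up to sign. -/
noncomputable def negImSum {κ : Type*} [Fintype κ] (c : ℝ) (u : κ → ℝ) (e : κ → ℂ) : ℝ :=
  ∑ k, c * u k * ((e k).im / ‖1 + (c : ℂ) * e k‖ ^ 2)

/-- The denominator `∑ k, u k / (1 + c e k) - z`. -/
noncomputable def resolventDenom {κ : Type*} [Fintype κ] (c : ℝ) (u : κ → ℝ) (z : ℂ)
    (e : κ → ℂ) : ℂ :=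
  ∑ k, (u k : ℂ) * (1 + (c : ℂ) * e k)⁻¹ - z

section

variable {κ ι : Type*} [Fintype κ] [Fintype ι] {c : ℝ} {z : ℂ} {e f : κ → ℂ}

theorem negImSum_nonneg {u : κ → ℝ} (hc : 0 < c) (hu : ∀ k, 0 ≤ u k)
    (he : ∀ k, 0 < (e k).im) : 0 ≤ negImSum c u e :=
  Finset.sum_nonneg fun k _ => by
    have := hu k
    have := he k
    positivity

theorem resolventDenom_im (u : κ → ℝ) : (resolventDenom c u z e).im = -negImSum c u e - z.im := by
  simp only [resolventDenom, negImSum, Complex.sub_im, Complex.im_sum, im_ofReal_mul_inv]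
  rw [← Finset.sum_neg_distrib]
  congr 1
  refine Finset.sum_congr rfl fun k _ => ?_
  simp
  ring

theorem resolventDenom_im_neg {u : κ → ℝ} (hc : 0 < c) (hu : ∀ k, 0 ≤ u k)
    (he : ∀ k, 0 < (e k).im) (hz : 0 < z.im) : (resolventDenom c u z e).im < 0 := by
  rw [resolventDenom_im]
  linarith [negImSum_nonneg hc hu he]

theorem one_add_mul_ne_zero_of_im_pos (hc : 0 < c) {x : ℂ} (hx : 0 < x.im) :
    1 + (c : ℂ) * x ≠ 0 := by
  intro h
  have := congrArg Complex.im h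
  simp [hc.ne', hx.ne'] at this

theorem resolventDenom_ne_zero {u : κ → ℝ} (hc : 0 < c) (hu : ∀ k, 0 ≤ u k)
    (he : ∀ k, 0 < (e k).im) (hz : 0 < z.im) : resolventDenom c u z e ≠ 0 := by
  intro h
  simpa [h] using resolventDenom_im_neg hc hu he hz

theorem resolventDenom_sub {u : κ → ℝ} (hc : 0 < c) (he : ∀ k, 0 < (e k).im)
    (hf : ∀ k, 0 < (f k).im) :
    resolventDenom c u z f - resolventDenom c u z e =
      ∑ k, ((c * u k : ℝ) : ℂ) *
        ((e k - f k) / ((1 + (c : ℂ) * e k) * (1 + (c : ℂ) * f k))) := by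
  rw [resolventDenom, resolventDenom, sub_sub_sub_cancel_right, ← Finset.sum_sub_distrib]
  refine Finset.sum_congr rfl fun k _ => ?_
  have h1 := one_add_mul_ne_zero_of_im_pos hc (he k)
  have h2 := one_add_mul_ne_zero_of_im_pos hc (hf k)
  push_cast
  field_simp
  ring

/-- The imaginary part of the fixed-point equation, as a strict inequality. -/
theorem sum_negImSum_lt_im {u : ι → κ → ℝ} {w : ι → ℝ} {x : ℂ} (hc : 0 < c)
    (hu : ∀ i k, 0 ≤ u i k) (hw : ∀ i, 0 ≤ w i) (hw' : ∃ i, w i ≠ 0) (hz : 0 < z.im)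
    (he : ∀ k, 0 < (e k).im)
    (hx : x = ∑ i, (w i : ℂ) * (resolventDenom c (u i) z e)⁻¹) :
    ∑ i, w i * (negImSum c (u i) e / ‖resolventDenom c (u i) z e‖ ^ 2) < x.im := by
  simp only [hx, Complex.im_sum, im_ofReal_mul_inv, resolventDenom_im]
  have hD i := norm_pos_iff.2 (resolventDenom_ne_zero hc (hu i) he hz)
  refine Finset.sum_lt_sum (fun i _ => ?_) ?_
  · have := hw i
    have := hD i
    gcongr
    linarith
  · obtain ⟨i, hi⟩ := hw'
    have := (hw i).lt_of_ne' hi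
    have := hD i
    refine ⟨i, Finset.mem_univ i, ?_⟩
    gcongr
    linarith

/-- A fixed-point system of resolvent type has at most one solution in the upper half-plane. -/
theorem eq_of_resolvent_system {u : ι → κ → ℝ} {w : κ → ι → ℝ} (hc : 0 < c)
    (hu : ∀ i k, 0 ≤ u i k) (hw : ∀ j i, 0 ≤ w j i) (hw' : ∀ j, ∃ i, w j i ≠ 0)
    (hz : 0 < z.im) (he : ∀ k, 0 < (e k).im) (hf : ∀ k, 0 < (f k).im)
    (hes : ∀ j, e j = ∑ i, (w j i : ℂ) * (resolventDenom c (u i) z e)⁻¹)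
    (hfs : ∀ j, f j = ∑ i, (w j i : ℂ) * (resolventDenom c (u i) z f)⁻¹) : e = f := by
  by_contra hne
  obtain ⟨j₀, hj₀⟩ := Function.ne_iff.1 hne
  have hs k : 0 < √(e k).im * √(f k).im :=
    mul_pos (Real.sqrt_pos.2 (he k)) (Real.sqrt_pos.2 (hf k))
  let ρ : κ → ℝ := fun k => ‖e k - f k‖ / (√(e k).im * √(f k).im)
  obtain ⟨j, -, hj⟩ := Finset.exists_max_image Finset.univ ρ ⟨j₀, Finset.mem_univ _⟩
  have hM : 0 < ρ j :=
    (div_pos (norm_pos_iff.2 (sub_ne_zero.2 hj₀)) (hs j₀)).trans_le (hj j₀ (Finset.mem_univ _))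
  have hδ k : ‖e k - f k‖ ≤ ρ j * (√(e k).im * √(f k).im) :=
    (div_le_iff₀ (hs k)).1 (hj k (Finset.mem_univ k))
  have hΔ i : ‖resolventDenom c (u i) z f - resolventDenom c (u i) z e‖ ≤
      ρ j * (√(negImSum c (u i) e) * √(negImSum c (u i) f)) := by
    rw [resolventDenom_sub hc he hf]
    exact norm_sum_mul_div_le hM.le (fun k => mul_nonneg hc.le (hu i k)) (fun k => (he k).le)
      (fun k => (hf k).le) hδ
  have hdiff : e j - f j = ∑ i, (w j i : ℂ) *
      ((resolventDenom c (u i) z f - resolventDenom c (u i) z e) /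
        (resolventDenom c (u i) z e * resolventDenom c (u i) z f)) := by
    rw [hes j, hfs j, ← Finset.sum_sub_distrib]
    refine Finset.sum_congr rfl fun i _ => ?_
    have h1 := resolventDenom_ne_zero hc (hu i) he hz
    have h2 := resolventDenom_ne_zero hc (hu i) hf hz
    field_simp
  have hlt : ‖e j - f j‖ < ρ j * (√(e j).im * √(f j).im) := by
    conv_lhs => rw [hdiff]
    refine (norm_sum_mul_div_le hM.le (hw j) (fun i => negImSum_nonneg hc (hu i) he)
      (fun i => negImSum_nonneg hc (hu i) hf) hΔ).trans_lt (mul_lt_mul_of_pos_left ?_ hM)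
    exact mul_lt_mul''
      ((Real.sqrt_lt_sqrt_iff_of_pos (he j)).2
        (sum_negImSum_lt_im hc hu (hw j) (hw' j) hz he (hes j)))
      ((Real.sqrt_lt_sqrt_iff_of_pos (hf j)).2
        (sum_negImSum_lt_im hc hu (hw j) (hw' j) hz hf (hfs j)))
      (Real.sqrt_nonneg _) (Real.sqrt_nonneg _)
  exact hlt.ne (div_mul_cancel₀ _ (hs j).ne').symm

end

/-- Uniqueness of solutions in `(ℂ⁺)^N` of the system
`e_j = (1/n) Σ_i d_{ij}² / [ (1/N) Σ_k d_{ik}²/(1 + (n/N) e_k) − z ]`. -/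
theorem uniqueness_of_system_solution
    (n N : ℕ) (hn : 0 < n) (hN : 0 < N)
    (d : Matrix (Fin n) (Fin N) ℝ) (hd : ∀ i j, 0 ≤ d i j)
    (hcol : ∀ j, ∃ i, d i j ≠ 0)
    (z : ℂ) (hz : 0 < z.im)
    (e e' : Fin N → ℂ)
    (he : ∀ j, 0 < (e j).im ∧
      e j = (n : ℂ)⁻¹ * ∑ i : Fin n, ((d i j : ℂ)) ^ 2 /
        ((N : ℂ)⁻¹ * (∑ k : Fin N, ((d i k : ℂ)) ^ 2 / (1 + ((n : ℂ) / (N : ℂ)) * e k)) - z))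
    (he' : ∀ j, 0 < (e' j).im ∧
      e' j = (n : ℂ)⁻¹ * ∑ i : Fin n, ((d i j : ℂ)) ^ 2 /
        ((N : ℂ)⁻¹ * (∑ k : Fin N, ((d i k : ℂ)) ^ 2 / (1 + ((n : ℂ) / (N : ℂ)) * e' k)) - z)) :
    e = e' := by
  have hn' : (0 : ℝ) < n := Nat.cast_pos.2 hn
  have hN' : (0 : ℝ) < N := Nat.cast_pos.2 hN
  have hsys : ∀ g : Fin N → ℂ, (∀ j, g j = (n : ℂ)⁻¹ * ∑ i : Fin n, ((d i j : ℂ)) ^ 2 /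
        ((N : ℂ)⁻¹ * (∑ k : Fin N, ((d i k : ℂ)) ^ 2 / (1 + ((n : ℂ) / (N : ℂ)) * g k)) - z)) →
      ∀ j, g j = ∑ i, (((n : ℝ)⁻¹ * d i j ^ 2 : ℝ) : ℂ) *
        (resolventDenom ((n : ℝ) / N) (fun k => (N : ℝ)⁻¹ * d i k ^ 2) z g)⁻¹ := by
    intro g hg j
    conv_lhs => rw [hg j]
    simp only [resolventDenom, Finset.mul_sum, div_eq_mul_inv, mul_assoc, Complex.ofReal_mul,
      Complex.ofReal_inv, Complex.ofReal_pow, Complex.ofReal_natCast]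
  refine eq_of_resolvent_system (c := (n : ℝ) / N) (div_pos hn' hN')
    (u := fun i k => (N : ℝ)⁻¹ * d i k ^ 2) (w := fun j i => (n : ℝ)⁻¹ * d i j ^ 2)
    (fun i k => by positivity) (fun j i => by positivity) (fun j => ?_) hz
    (fun k => (he k).1) (fun k => (he' k).1) (hsys e fun j => (he j).2) (hsys e' fun j => (he' j).2)
  obtain ⟨i, hi⟩ := hcol j
  exact ⟨i, by positivity⟩
end

section
/- Let n, N be positive integers and let (d_{ij}) be an n×N matrix of nonnegative reals such that every column contains a nonzero entry. For each z ∈ ℂ⁺ let e^0(z) = (e_1^0(z), …, e_N^0(z)) ∈ (ℂ⁺)^N be the unique solution of the system e_j^0(z) = (1/n) Σ_{i=1}^n d_{ij}² / [ (1/N) Σ_{k=1}^N d_{ik}²/(1 + (n/N)e_k^0(z)) − z ]. Then the map z ↦ e^0(z) is continuous on ℂ⁺. -/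
/-- The denominator appearing in the `i`-th summand of the system. -/
noncomputable def systemDenom {ι κ : Type*} [Fintype κ] (b c : ℝ) (d : ι → κ → ℝ) (z : ℂ)
    (e : κ → ℂ) (i : ι) : ℂ :=
  b * (∑ k, (d i k : ℂ) ^ 2 / (1 + c * e k)) - z

/-- The right-hand side of the system. -/
noncomputable def systemRhs {ι κ : Type*} [Fintype ι] [Fintype κ] (a b c : ℝ) (d : ι → κ → ℝ)
    (z : ℂ) (e : κ → ℂ) (j : κ) : ℂ :=
  a * ∑ i, (d i j : ℂ) ^ 2 / systemDenom b c d z e i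

open ComplexConjugate in
theorem im_mul_conj_systemDenom {ι κ : Type*} [Fintype κ] (b c : ℝ) (d : ι → κ → ℝ) (z : ℂ)
    (e : κ → ℂ) (i : ι) (w : ℂ) :
    (w * conj (systemDenom b c d z e i)).im =
      b * ∑ k, d i k ^ 2 * (w.im + c * (w * e k).im) / Complex.normSq (1 + c * e k)
        - (w * conj z).im := by
  have h : w * conj (systemDenom b c d z e i) =
      b * ∑ k, ((d i k ^ 2 / Complex.normSq (1 + c * e k) : ℝ) : ℂ) * (w * (1 + c * e k))
        - w * conj z := by
    simp only [systemDenom, map_sub, map_mul, map_sum, map_div₀, map_pow, Complex.conj_ofReal]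
    rw [mul_sub, mul_left_comm, Finset.mul_sum]
    congr 2
    refine Finset.sum_congr rfl fun k _ => ?_
    rw [div_eq_mul_inv, ← map_inv₀, Complex.inv_def, map_mul, Complex.conj_conj,
      Complex.conj_ofReal]
    push_cast
    ring
  rw [h, Complex.sub_im, Complex.im_ofReal_mul, Complex.im_sum]
  congr 2
  refine Finset.sum_congr rfl fun k _ => ?_
  rw [Complex.im_ofReal_mul, mul_add, Complex.add_im, mul_one, mul_left_comm,
    Complex.im_ofReal_mul]
  ring

open ComplexConjugate in
theorem im_mul_systemRhs {ι κ : Type*} [Fintype ι] [Fintype κ] (a b c : ℝ) (d : ι → κ → ℝ)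
    (z : ℂ) (e : κ → ℂ) (j : κ) (w : ℂ) :
    (w * systemRhs a b c d z e j).im =
      a * ∑ i, d i j ^ 2 * (w * conj (systemDenom b c d z e i)).im /
        Complex.normSq (systemDenom b c d z e i) := by
  have h : w * systemRhs a b c d z e j =
      a * ∑ i, ((d i j ^ 2 / Complex.normSq (systemDenom b c d z e i) : ℝ) : ℂ) *
        (w * conj (systemDenom b c d z e i)) := by
    rw [systemRhs, mul_left_comm, Finset.mul_sum]
    congr 1
    refine Finset.sum_congr rfl fun i _ => ?_
    rw [div_eq_mul_inv, Complex.inv_def]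
    push_cast
    ring
  rw [h, Complex.im_ofReal_mul, Complex.im_sum]
  congr 1
  refine Finset.sum_congr rfl fun i _ => ?_
  rw [Complex.im_ofReal_mul]
  ring

theorem im_systemDenom_le {ι κ : Type*} [Fintype κ] {b c : ℝ} (hb : 0 ≤ b) (hc : 0 ≤ c)
    (d : ι → κ → ℝ) (z : ℂ) {e : κ → ℂ} (he : ∀ k, 0 ≤ (e k).im) (i : ι) :
    (systemDenom b c d z e i).im ≤ -z.im := by
  have h := im_mul_conj_systemDenom b c d z e i 1
  simp only [one_mul, Complex.conj_im, Complex.one_im, zero_add] at h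
  have : 0 ≤ b * ∑ k, d i k ^ 2 * (c * (e k).im) / Complex.normSq (1 + c * e k) :=
    mul_nonneg hb (Finset.sum_nonneg fun k _ => div_nonneg
      (mul_nonneg (sq_nonneg _) (mul_nonneg hc (he k))) (Complex.normSq_nonneg _))
  linarith

theorem systemDenom_ne_zero {ι κ : Type*} [Fintype κ] {b c : ℝ} (hb : 0 ≤ b) (hc : 0 ≤ c)
    (d : ι → κ → ℝ) {z : ℂ} (hz : 0 < z.im) {e : κ → ℂ} (he : ∀ k, 0 ≤ (e k).im) (i : ι) :
    systemDenom b c d z e i ≠ 0 := by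
  intro h
  have := im_systemDenom_le hb hc d z he i
  rw [h, Complex.zero_im] at this
  linarith

open ComplexConjugate in
theorem im_mul_systemRhs_pos {ι κ : Type*} [Fintype ι] [Fintype κ] {a b c : ℝ} (ha : 0 < a)
    (hb : 0 ≤ b) (hc : 0 ≤ c) {d : ι → κ → ℝ} {z : ℂ} (hz : 0 < z.im) {e : κ → ℂ}
    (he : ∀ k, 0 ≤ (e k).im) {w : ℂ} (hw : 0 ≤ w.im) (hwe : ∀ k, 0 ≤ (w * e k).im)
    (hwz : (w * conj z).im < 0) {j : κ} (hj : ∃ i, d i j ≠ 0) :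
    0 < (w * systemRhs a b c d z e j).im := by
  have hD : ∀ i, 0 < (w * conj (systemDenom b c d z e i)).im := fun i => by
    rw [im_mul_conj_systemDenom]
    have : 0 ≤ b * ∑ k, d i k ^ 2 * (w.im + c * (w * e k).im) / Complex.normSq (1 + c * e k) :=
      mul_nonneg hb (Finset.sum_nonneg fun k _ => div_nonneg (mul_nonneg (sq_nonneg _)
        (add_nonneg hw (mul_nonneg hc (hwe k)))) (Complex.normSq_nonneg _))
    linarith
  rw [im_mul_systemRhs]
  obtain ⟨i, hi⟩ := hj
  refine mul_pos ha (Finset.sum_pos' (fun i _ => ?_) ⟨i, Finset.mem_univ i, ?_⟩)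
  · exact div_nonneg (mul_nonneg (sq_nonneg _) (hD i).le) (Complex.normSq_nonneg _)
  · exact div_pos (mul_pos (by positivity) (hD i))
      (Complex.normSq_pos.2 (systemDenom_ne_zero hb hc d hz he i))

/-- A solution in the upper half plane remains in the closed upper half plane after multiplication
by `z`. The proof is a maximum principle: `z` is replaced by `z - t`, with `t` the smallest ratio
`Im (z * e k) / Im (e k)`. -/
theorem im_mul_solution_nonneg {ι κ : Type*} [Fintype ι] [Fintype κ] {a b c : ℝ} (ha : 0 < a)
    (hb : 0 ≤ b) (hc : 0 ≤ c) {d : ι → κ → ℝ} (hcol : ∀ j, ∃ i, d i j ≠ 0) {z : ℂ}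
    (hz : 0 < z.im) {e : κ → ℂ} (he : ∀ k, 0 < (e k).im)
    (hsol : ∀ j, e j = systemRhs a b c d z e j) (k : κ) : 0 ≤ (z * e k).im := by
  by_contra! hk
  have : Nonempty κ := ⟨k⟩
  obtain ⟨j, hj⟩ := Finite.exists_min fun l => (z * e l).im / (e l).im
  set t : ℝ := (z * e j).im / (e j).im with ht
  have htneg : t < 0 := (hj k).trans_lt (div_neg_of_neg_of_pos hk (he k))
  have him : ∀ l, ((z - t) * e l).im = (z * e l).im - t * (e l).im := fun l => by
    rw [sub_mul, Complex.sub_im, Complex.im_ofReal_mul]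
  have hpos : 0 < ((z - t) * systemRhs a b c d z e j).im := by
    refine im_mul_systemRhs_pos ha hb hc hz (fun l => (he l).le) ?_ (fun l => ?_) ?_ (hcol j)
    · simpa using hz.le
    · rw [him]
      have := (le_div_iff₀ (he l)).1 (hj l)
      linarith
    · rw [sub_mul, Complex.mul_conj, Complex.sub_im, Complex.im_ofReal_mul, Complex.ofReal_im,
        Complex.conj_im]
      nlinarith
  rw [← hsol j, him, ht, div_mul_cancel₀ _ (he j).ne', sub_self] at hpos
  exact hpos.false

theorem norm_systemRhs_le {ι κ : Type*} [Fintype ι] [Fintype κ] {a b c : ℝ} (ha : 0 ≤ a)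
    (hb : 0 ≤ b) (hc : 0 ≤ c) (d : ι → κ → ℝ) {z : ℂ} {y : ℝ} (hy : 0 < y) (hz : y ≤ z.im)
    {e : κ → ℂ} (he : ∀ k, 0 ≤ (e k).im) (j : κ) :
    ‖systemRhs a b c d z e j‖ ≤ a * ∑ i, d i j ^ 2 / y := by
  rw [systemRhs, norm_mul, Complex.norm_real, Real.norm_of_nonneg ha]
  refine mul_le_mul_of_nonneg_left (norm_sum_le_of_le _ fun i _ => ?_) ha
  rw [norm_div, norm_pow, Complex.norm_real, Real.norm_eq_abs, sq_abs]
  have h1 := im_systemDenom_le hb hc d z he i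
  have h2 := Complex.abs_im_le_norm (systemDenom b c d z e i)
  have h3 := neg_abs_le (systemDenom b c d z e i).im
  exact div_le_div_of_nonneg_left (sq_nonneg _) hy (by linarith)

open Filter Topology in
theorem tendsto_systemRhs {ι κ : Type*} [Fintype ι] [Fintype κ] {a b c : ℝ} (hb : 0 ≤ b)
    (hc : 0 ≤ c) (d : ι → κ → ℝ) {z : ℂ} (hz : 0 < z.im) {e : κ → ℂ}
    (he : ∀ k, 0 ≤ (e k).im) (hne : ∀ k, 1 + c * e k ≠ 0) {F : Filter ℂ} (hF : F ≤ 𝓝 z)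
    {f : ℂ → κ → ℂ} (hf : Tendsto f F (𝓝 e)) (j : κ) :
    Tendsto (fun x => systemRhs a b c d x (f x) j) F (𝓝 (systemRhs a b c d z e j)) := by
  refine (tendsto_finsetSum _ fun i _ => tendsto_const_nhds.div ?_
    (systemDenom_ne_zero hb hc d hz he i)).const_mul _
  refine ((tendsto_finsetSum _ fun k _ => tendsto_const_nhds.div ?_ (hne k)).const_mul _).sub hF
  exact ((tendsto_pi_nhds.1 hf k).const_mul _).const_add _

open Filter Topology in
theorem continuousOn_of_unique_solution {ι κ : Type*} [Fintype ι] [Fintype κ] {a b c : ℝ}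
    (ha : 0 < a) (hb : 0 ≤ b) (hc : 0 ≤ c) {d : ι → κ → ℝ} (hcol : ∀ j, ∃ i, d i j ≠ 0)
    {e : ℂ → κ → ℂ}
    (he : ∀ z : ℂ, 0 < z.im → ∀ j, 0 < (e z j).im ∧ e z j = systemRhs a b c d z (e z) j)
    (huniq : ∀ z : ℂ, 0 < z.im → ∀ e' : κ → ℂ,
      (∀ j, 0 < (e' j).im ∧ e' j = systemRhs a b c d z e' j) → e' = e z) :
    ContinuousOn e {z : ℂ | 0 < z.im} := by
  intro z (hz : 0 < z.im)
  have hev : ∀ᶠ x in 𝓝[{z : ℂ | 0 < z.im}] z, z.im / 2 < x.im :=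
    mem_nhdsWithin_of_mem_nhds
      ((isOpen_lt continuous_const Complex.continuous_im).mem_nhds (half_lt_self hz))
  refine (isCompact_univ_pi fun j =>
    isCompact_closedBall (0 : ℂ) (a * ∑ i, d i j ^ 2 / (z.im / 2))).tendsto_nhds_of_unique_mapClusterPt
    ?_ fun e' _ hcluster => huniq z hz e' ?_
  · filter_upwards [hev] with x hx j _
    have hx0 : 0 < x.im := (half_pos hz).trans hx
    rw [mem_closedBall_zero_iff, (he x hx0 j).2]
    exact norm_systemRhs_le ha.le hb hc d (half_pos hz) hx.le (fun k => (he x hx0 k).1.le) j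
  · obtain ⟨U, hU, hlim⟩ := mapClusterPt_iff_ultrafilter.1 hcluster
    have hUz : (U : Filter ℂ) ≤ 𝓝 z := hU.trans nhdsWithin_le_nhds
    have hUpos : ∀ᶠ x in (U : Filter ℂ), 0 < x.im := hU self_mem_nhdsWithin
    have hcoord : ∀ k, Tendsto (fun x => e x k) U (𝓝 (e' k)) := tendsto_pi_nhds.1 hlim
    have him : ∀ k, 0 ≤ (e' k).im := fun k =>
      ge_of_tendsto ((Complex.continuous_im.tendsto _).comp (hcoord k))
        (hUpos.mono fun x hx => (he x hx k).1.le)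
    have hzim : ∀ k, 0 ≤ (z * e' k).im := fun k => by
      have hmul : Tendsto (fun x => x * e x k) U (𝓝 (z * e' k)) := Tendsto.mul hUz (hcoord k)
      exact ge_of_tendsto ((Complex.continuous_im.tendsto _).comp hmul)
        (hUpos.mono fun x hx => im_mul_solution_nonneg ha hb hc hcol hx
          (fun l => (he x hx l).1) (fun l => (he x hx l).2) k)
    have hne : ∀ k, 1 + c * e' k ≠ 0 := fun k h => by
      have h' : (z * (1 + c * e' k)).im = z.im + c * (z * e' k).im := by
        rw [mul_add, Complex.add_im, mul_one, mul_left_comm, Complex.im_ofReal_mul]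
      rw [h, mul_zero, Complex.zero_im] at h'
      have := mul_nonneg hc (hzim k)
      linarith
    have hsol : ∀ j, e' j = systemRhs a b c d z e' j := fun j =>
      tendsto_nhds_unique (hcoord j) ((tendsto_systemRhs hb hc d hz him hne hUz hlim j).congr'
        (hUpos.mono fun x hx => ((he x hx j).2).symm))
    refine fun j => ⟨?_, hsol j⟩
    rw [hsol j, ← one_mul (systemRhs a b c d z e' j)]
    exact im_mul_systemRhs_pos ha hb hc hz him (by simp) (by simpa using him) (by simpa using hz)
      (hcol j)

/-- The unique `(ℂ⁺)^N`-valued solution `e⁰(z)` of the system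
`e_j⁰(z) = (1/n) Σ_i d_{ij}² / [ (1/N) Σ_k d_{ik}²/(1 + (n/N) e_k⁰(z)) − z ]` depends
continuously on `z ∈ ℂ⁺`. -/
theorem continuousOn_e0
    (n N : ℕ) (hn : 0 < n) (hN : 0 < N)
    (d : Matrix (Fin n) (Fin N) ℝ) (hd : ∀ i j, 0 ≤ d i j)
    (hcol : ∀ j, ∃ i, d i j ≠ 0)
    (e0 : ℂ → Fin N → ℂ)
    (he0 : ∀ z : ℂ, 0 < z.im → ∀ j, 0 < (e0 z j).im ∧
      e0 z j = (n : ℂ)⁻¹ * ∑ i : Fin n, ((d i j : ℂ)) ^ 2 /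
        ((N : ℂ)⁻¹ * (∑ k : Fin N, ((d i k : ℂ)) ^ 2 / (1 + ((n : ℂ) / (N : ℂ)) * e0 z k)) - z))
    (he0uniq : ∀ z : ℂ, 0 < z.im → ∀ e' : Fin N → ℂ,
      (∀ j, 0 < (e' j).im ∧
        e' j = (n : ℂ)⁻¹ * ∑ i : Fin n, ((d i j : ℂ)) ^ 2 /
          ((N : ℂ)⁻¹ * (∑ k : Fin N, ((d i k : ℂ)) ^ 2 / (1 + ((n : ℂ) / (N : ℂ)) * e' k)) - z))
      → e' = e0 z) :
    ContinuousOn e0 {z : ℂ | 0 < z.im} := by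
  have hn' : (0 : ℝ) < (n : ℝ)⁻¹ := by positivity
  have hrhs : ∀ z e' j, systemRhs (n : ℝ)⁻¹ (N : ℝ)⁻¹ ((n : ℝ) / N) d z e' j =
      (n : ℂ)⁻¹ * ∑ i : Fin n, ((d i j : ℂ)) ^ 2 /
        ((N : ℂ)⁻¹ * (∑ k : Fin N, ((d i k : ℂ)) ^ 2 /
          (1 + ((n : ℂ) / (N : ℂ)) * e' k)) - z) := fun z e' j => by
    simp only [systemRhs, systemDenom]
    push_cast
    rfl
  refine continuousOn_of_unique_solution hn' (by positivity : (0 : ℝ) ≤ (N : ℝ)⁻¹)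
    (by positivity : (0 : ℝ) ≤ (n : ℝ) / N) hcol ?_ ?_
  · simpa only [hrhs] using he0
  · simpa only [hrhs] using he0uniq
end

section
/- Let {μ_n} be a sequence of sub-probability measures on ℝ (measures with total mass at most 1), and suppose the Stieltjes transforms m_{μ_n}(z) converge (to some limit depending on z) for every z in an infinite set S ⊂ ℂ⁺ that has a cluster point in ℂ⁺ and satisfies inf{Im z : z ∈ S} > 0. Then there exists a sub-probability measure μ on ℝ such that μ_n converges vaguely to μ, i.e., D(μ_n, μ) → 0. -/
open MeasureTheory Filter
open scoped ENNReal Topology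

/-- The tent function of height `1/(m+1)`: it equals `1/(m+1)` on `[a, b]`, vanishes outside
`(a - 1/(m+1), b + 1/(m+1))`, and is linear in between. -/
noncomputable def tentFun (m : ℕ) (a b : ℚ) (x : ℝ) : ℝ :=
  ((m : ℝ) + 1)⁻¹ *
    max 0 (min 1 (min (((m : ℝ) + 1) * (x - (a : ℝ) + ((m : ℝ) + 1)⁻¹))
      (((m : ℝ) + 1) * ((b : ℝ) + ((m : ℝ) + 1)⁻¹ - x))))

/-- The metric `D(F, G) = Σ_i |∫ f_i dF − ∫ f_i dG| 2^{-i}`, which metrizes vague convergence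
of sub-probability measures. -/
noncomputable def Dmetric (μ ν : Measure ℝ) : ℝ :=
  ∑' p : ℕ × ℚ × ℚ,
    |(∫ x, tentFun p.1 p.2.1 p.2.2 x ∂μ) - ∫ x, tentFun p.1 p.2.1 p.2.2 x ∂ν| *
      (2 : ℝ) ^ (-(Encodable.encode p : ℤ) - 1)

/-- The Stieltjes transform `m_μ(z) = ∫ (x − z)⁻¹ dμ(x)` of a measure on `ℝ`. -/
noncomputable def stieltjesTransform (μ : Measure ℝ) (z : ℂ) : ℂ :=
  ∫ x, ((x : ℂ) - z)⁻¹ ∂μ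

open scoped CompactlySupported

/-- The continuous extension of `x ↦ (x - z)⁻¹` to the one-point compactification of `ℝ`
(and `0` for real `z`). -/
noncomputable def resolventMap (z : ℂ) : C(OnePoint ℝ, ℂ) :=
  open Classical in
  if hz : z.im ≠ 0 then
    OnePoint.continuousMapMk
      ⟨fun x : ℝ => ((x : ℂ) - z)⁻¹, by
        refine Continuous.inv₀ (by fun_prop) fun x hx => hz ?_
        simpa using congrArg Complex.im hx⟩ 0
      (by
        have h : Tendsto (fun x : ℝ => (x : ℂ) - z) (cocompact ℝ) (cocompact ℂ) := by
          rw [← Metric.cobounded_eq_cocompact, ← Metric.cobounded_eq_cocompact,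
            ← tendsto_norm_atTop_iff_cobounded]
          refine tendsto_atTop_mono (f := fun x : ℝ => ‖x‖ - ‖z‖) (fun x => ?_)
            (tendsto_atTop_add_const_right _ _ tendsto_norm_cobounded_atTop)
          simpa using norm_sub_norm_le (x : ℂ) z
        rw [coclosedCompact_eq_cocompact]
        exact (tendsto_inv₀_cobounded).comp (by rwa [Metric.cobounded_eq_cocompact]))
  else 0

section resolventMap

variable {z w : ℂ}

lemma resolventMap_coe (hz : z.im ≠ 0) (x : ℝ) :
    resolventMap z (x : OnePoint ℝ) = ((x : ℂ) - z)⁻¹ := by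
  simp only [resolventMap, dif_pos hz]; rfl

lemma resolventMap_infty : resolventMap z OnePoint.infty = 0 := by
  unfold resolventMap
  split_ifs <;> rfl

lemma ofReal_sub_ne_zero (hz : z.im ≠ 0) (x : ℝ) : (x : ℂ) - z ≠ 0 := fun hx =>
  hz (by simpa using congrArg Complex.im hx)

/-- The first resolvent identity. -/
lemma resolventMap_sub (hz : z.im ≠ 0) (hw : w.im ≠ 0) :
    resolventMap z - resolventMap w = (z - w) • (resolventMap z * resolventMap w) := by
  ext x
  induction x using OnePoint.rec with
  | infty => simp [resolventMap_infty]
  | coe x =>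
    have h1 := ofReal_sub_ne_zero hz x
    have h2 := ofReal_sub_ne_zero hw x
    simp only [ContinuousMap.sub_apply, ContinuousMap.smul_apply, ContinuousMap.mul_apply,
      resolventMap_coe hz, resolventMap_coe hw, smul_eq_mul]
    field_simp
    ring

lemma star_resolventMap (hz : z.im ≠ 0) :
    star (resolventMap z) = resolventMap (starRingEnd ℂ z) := by
  have hz' : (starRingEnd ℂ z).im ≠ 0 := by simpa using hz
  ext x
  induction x using OnePoint.rec with
  | infty => simp [resolventMap_infty]
  | coe x => simp [resolventMap_coe hz, resolventMap_coe hz']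

lemma norm_resolventMap_le (hz : z.im ≠ 0) : ‖resolventMap z‖ ≤ |z.im|⁻¹ := by
  rw [ContinuousMap.norm_le _ (by positivity)]
  intro x
  induction x using OnePoint.rec with
  | infty => simp [resolventMap_infty]
  | coe x =>
    rw [resolventMap_coe hz, norm_inv]
    have := Complex.abs_im_le_norm ((x : ℂ) - z)
    simp only [Complex.sub_im, Complex.ofReal_im, zero_sub, abs_neg] at this
    gcongr

lemma eventually_im_ne_zero (hz : z.im ≠ 0) : ∀ᶠ w : ℂ in 𝓝 z, w.im ≠ 0 :=
  Complex.continuous_im.continuousAt.eventually_ne hz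

lemma continuousAt_resolventMap (hz : z.im ≠ 0) : ContinuousAt resolventMap z := by
  rw [ContinuousAt, tendsto_iff_norm_sub_tendsto_zero]
  have hlim : Tendsto (fun w : ℂ => ‖w - z‖ * (|w.im|⁻¹ * |z.im|⁻¹)) (𝓝 z) (𝓝 0) := by
    have h : ContinuousAt (fun w : ℂ => ‖w - z‖ * (|w.im|⁻¹ * |z.im|⁻¹)) z :=
      by
      have : |z.im| ≠ 0 := abs_ne_zero.mpr hz
      fun_prop (disch := assumption)
    simpa [ContinuousAt] using h
  refine squeeze_zero' (.of_forall fun _ => norm_nonneg _) ?_ hlim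
  filter_upwards [eventually_im_ne_zero hz] with w hw
  rw [resolventMap_sub hw hz, norm_smul]
  gcongr
  refine (norm_mul_le _ _).trans ?_
  gcongr
  · exact norm_resolventMap_le hw
  · exact norm_resolventMap_le hz

lemma hasDerivAt_resolventMap (hz : z.im ≠ 0) :
    HasDerivAt resolventMap (resolventMap z * resolventMap z) z := by
  rw [hasDerivAt_iff_tendsto_slope]
  have h : Tendsto (fun w => resolventMap w * resolventMap z) (𝓝[≠] z)
      (𝓝 (resolventMap z * resolventMap z)) :=
    ((continuousAt_resolventMap hz).tendsto.mul_const _).mono_left nhdsWithin_le_nhds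
  refine h.congr' ?_
  filter_upwards [nhdsWithin_le_nhds (eventually_im_ne_zero hz), self_mem_nhdsWithin] with w hw hne
  rw [slope_def_module, resolventMap_sub hw hz, smul_smul,
    inv_mul_cancel₀ (sub_ne_zero.mpr hne), one_smul]

end resolventMap

/-- A closed subspace containing the resolvents at a set of points accumulating in the upper
half-plane contains the resolvents at all points of the upper half-plane. -/
lemma resolventMap_mem_of_accPt (V : Submodule ℂ C(OnePoint ℝ, ℂ))
    (hV : IsClosed (V : Set C(OnePoint ℝ, ℂ))) {S : Set ℂ} (hS : ∀ z ∈ S, resolventMap z ∈ V)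
    {z₀ : ℂ} (hz₀ : 0 < z₀.im) (hacc : AccPt z₀ (𝓟 S)) {z : ℂ} (hz : 0 < z.im) :
    resolventMap z ∈ V := by
  have : IsClosed (V : Set C(OnePoint ℝ, ℂ)) := hV
  let q : ℂ → C(OnePoint ℝ, ℂ) ⧸ V := fun z => V.mkQL (resolventMap z)
  have hU : IsOpen {z : ℂ | 0 < z.im} := isOpen_lt continuous_const Complex.continuous_im
  have hdiff : DifferentiableOn ℂ q {z : ℂ | 0 < z.im} := fun z hz =>
    ((V.mkQL.hasFDerivAt.comp_hasDerivAt z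
      (hasDerivAt_resolventMap (ne_of_gt hz))).differentiableAt).differentiableWithinAt
  have hzero := (hdiff.analyticOnNhd hU).eqOn_zero_of_preconnected_of_frequently_eq_zero
    (convex_halfSpace_im_gt 0).isPreconnected hz₀
    ((accPt_iff_frequently_nhdsNE.mp hacc).mono fun w hw => by
      simpa [q] using hS w hw) hz
  simpa [q] using hzero

/-- A closed subspace containing the constants and all resolvents at non-real points is everything,
by Stone–Weierstrass. -/
lemma eq_top_of_resolventMap_mem (V : Submodule ℂ C(OnePoint ℝ, ℂ))
    (hV : IsClosed (V : Set C(OnePoint ℝ, ℂ))) (h1 : 1 ∈ V)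
    (hr : ∀ z : ℂ, z.im ≠ 0 → resolventMap z ∈ V) : V = ⊤ := by
  let R : Set C(OnePoint ℝ, ℂ) := resolventMap '' {z : ℂ | z.im ≠ 0}
  let W : Submodule ℂ C(OnePoint ℝ, ℂ) := (Submodule.span ℂ (insert 1 R)).topologicalClosure
  have hWV : W ≤ V := Submodule.topologicalClosure_minimal _
    (Submodule.span_le.mpr (by
      rintro _ (rfl | ⟨z, hz, rfl⟩)
      exacts [h1, hr z hz])) hV
  have hgen : insert 1 R ⊆ (W : Set C(OnePoint ℝ, ℂ)) :=
    Submodule.subset_span.trans (Submodule.le_topologicalClosure _)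
  have hrW : ∀ z : ℂ, z.im ≠ 0 → resolventMap z ∈ W := fun z hz =>
    hgen (.inr ⟨z, hz, rfl⟩)
  have hWc : IsClosed (W : Set C(OnePoint ℝ, ℂ)) := Submodule.isClosed_topologicalClosure _
  have hmulne : ∀ z w : ℂ, z.im ≠ 0 → w.im ≠ 0 → z ≠ w → resolventMap z * resolventMap w ∈ W := by
    intro z w hz hw hne
    have h := W.smul_mem (z - w)⁻¹ (W.sub_mem (hrW z hz) (hrW w hw))
    rwa [resolventMap_sub hz hw, smul_smul, inv_mul_cancel₀ (sub_ne_zero.mpr hne), one_smul] at h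
  have hmul : ∀ z w : ℂ, z.im ≠ 0 → w.im ≠ 0 → resolventMap z * resolventMap w ∈ W := by
    intro z w hz hw
    refine hWc.mem_of_tendsto (b := 𝓝[≠] z)
      (((continuousAt_resolventMap hz).tendsto.mono_left nhdsWithin_le_nhds).mul_const
        (resolventMap w)) ?_
    rcases eq_or_ne z w with rfl | hne
    · filter_upwards [nhdsWithin_le_nhds (eventually_im_ne_zero hz), self_mem_nhdsWithin]
        with u hu hne using hmulne u z hu hz hne
    · filter_upwards [nhdsWithin_le_nhds (eventually_im_ne_zero hz),
        nhdsWithin_le_nhds (isOpen_ne.mem_nhds hne)] with u hu hne using hmulne u w hu hw hne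
  have hstable : ∀ z : ℂ, z.im ≠ 0 → ∀ g ∈ W, resolventMap z * g ∈ W := by
    intro z hz
    have hle : W ≤ W.comap (LinearMap.mulLeft ℂ (resolventMap z)) := by
      refine Submodule.topologicalClosure_minimal _ (Submodule.span_le.mpr ?_)
        (hWc.preimage (continuous_const_mul (resolventMap z)))
      rintro _ (rfl | ⟨w, hw, rfl⟩)
      · simpa using hrW z hz
      · simpa using hmul z w hz hw
    exact fun g hg => hle hg
  have hRstar : R ∪ star R = R := by
    refine Set.union_eq_left.mpr fun g hg => ?_
    obtain ⟨z, hz, hzg⟩ := Set.mem_star.mp hg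
    refine ⟨starRingEnd ℂ z, by simpa using hz, ?_⟩
    rw [← star_resolventMap hz, hzg, star_star]
  have hadj : ∀ g ∈ StarAlgebra.adjoin ℂ R, g ∈ W := by
    intro g hg
    have hg' : g ∈ Subalgebra.toSubmodule (Algebra.adjoin ℂ (R ∪ star R)) := hg
    rw [hRstar, Algebra.adjoin_eq_span] at hg'
    refine Submodule.span_le.mpr (fun m hm => ?_) hg'
    induction hm using Submonoid.closure_induction_left with
    | one => exact hgen (.inl rfl)
    | mul_left x hx y _ ih =>
      obtain ⟨z, hz, rfl⟩ := hx
      exact hstable z hz y ih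
  have hI : Complex.I.im ≠ 0 := by simp
  have hsep : (StarAlgebra.adjoin ℂ R).SeparatesPoints := by
    intro x y hxy
    refine ⟨resolventMap Complex.I, ⟨_, StarAlgebra.subset_adjoin ℂ R ⟨_, hI, rfl⟩, rfl⟩, ?_⟩
    induction x using OnePoint.rec with
    | infty =>
      induction y using OnePoint.rec with
      | infty => exact absurd rfl hxy
      | coe y =>
        rw [resolventMap_infty, resolventMap_coe hI]
        exact (inv_ne_zero (ofReal_sub_ne_zero hI y)).symm
    | coe x =>
      induction y using OnePoint.rec with
      | infty =>
        rw [resolventMap_infty, resolventMap_coe hI]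
        exact inv_ne_zero (ofReal_sub_ne_zero hI x)
      | coe y =>
        rw [resolventMap_coe hI, resolventMap_coe hI]
        simpa using hxy
  have htop := ContinuousMap.starSubalgebra_topologicalClosure_eq_top_of_separatesPoints _ hsep
  refine eq_top_iff.mpr fun g _ => hWV ?_
  have hg : g ∈ (StarAlgebra.adjoin ℂ R).topologicalClosure := htop ▸ StarSubalgebra.mem_top
  exact closure_minimal (fun g hg => hadj g hg) hWc hg

/-- The functional `F ↦ ∫ (F x - F ∞) dμ` on the continuous functions on the one-point
compactification of `ℝ`. -/
noncomputable def integralSubInfty (μ : Measure ℝ) [IsFiniteMeasure μ] :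
    C(OnePoint ℝ, ℂ) →L[ℂ] ℂ :=
  have integrable_sub : ∀ F : C(OnePoint ℝ, ℂ),
      Integrable (fun x : ℝ => F (x : OnePoint ℝ) - F OnePoint.infty) μ := fun F =>
    Integrable.of_bound
      (((F.continuous.comp OnePoint.continuous_coe).sub continuous_const).aestronglyMeasurable)
      (‖F‖ + ‖F‖) (.of_forall fun x =>
        (norm_sub_le _ _).trans (add_le_add (F.norm_coe_le_norm _) (F.norm_coe_le_norm _)))
  LinearMap.mkContinuous
    { toFun := fun F => ∫ x : ℝ, (F (x : OnePoint ℝ) - F OnePoint.infty) ∂μ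
      map_add' := fun F G => by
        rw [← integral_add (integrable_sub F) (integrable_sub G)]
        refine integral_congr_ae (.of_forall fun x => ?_)
        simp only [ContinuousMap.add_apply]
        ring
      map_smul' := fun c F => by
        rw [RingHom.id_apply, ← integral_smul]
        refine integral_congr_ae (.of_forall fun x => ?_)
        simp only [ContinuousMap.smul_apply, smul_sub] }
    (2 * μ.real Set.univ) fun F => by
      refine (norm_integral_le_of_norm_le_const (C := ‖F‖ + ‖F‖) (.of_forall fun x =>
        (norm_sub_le _ _).trans
          (add_le_add (F.norm_coe_le_norm _) (F.norm_coe_le_norm _)))).trans_eq ?_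
      ring

section integralSubInfty

variable (μ : Measure ℝ) [IsFiniteMeasure μ]

lemma integralSubInfty_apply (F : C(OnePoint ℝ, ℂ)) :
    integralSubInfty μ F = ∫ x : ℝ, (F (x : OnePoint ℝ) - F OnePoint.infty) ∂μ := rfl

lemma norm_integralSubInfty_le : ‖integralSubInfty μ‖ ≤ 2 * μ.real Set.univ := by
  unfold integralSubInfty
  exact LinearMap.mkContinuous_norm_le _ (by positivity) _

lemma integralSubInfty_one : integralSubInfty μ 1 = 0 := by
  simp [integralSubInfty_apply]

lemma integralSubInfty_star (F : C(OnePoint ℝ, ℂ)) :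
    integralSubInfty μ (star F) = starRingEnd ℂ (integralSubInfty μ F) := by
  simp only [integralSubInfty_apply, ← integral_conj]
  simp

lemma integralSubInfty_resolventMap {z : ℂ} (hz : z.im ≠ 0) :
    integralSubInfty μ (resolventMap z) = stieltjesTransform μ z := by
  simp [integralSubInfty_apply, stieltjesTransform, resolventMap_infty, resolventMap_coe hz]

end integralSubInfty

/-- The subspace of vectors at which a sequence of continuous linear functionals converges. -/
def convergenceSubmodule {E : Type*} [NormedAddCommGroup E] [NormedSpace ℂ E]
    (φ : ℕ → E →L[ℂ] ℂ) : Submodule ℂ E where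
  carrier := {x | ∃ L, Tendsto (fun n => φ n x) atTop (𝓝 L)}
  add_mem' := by
    rintro x y ⟨L, hL⟩ ⟨M, hM⟩
    exact ⟨L + M, by simpa using hL.add hM⟩
  zero_mem' := ⟨0, by simp⟩
  smul_mem' := by
    rintro c x ⟨L, hL⟩
    exact ⟨c • L, by simpa using hL.const_smul c⟩

lemma isClosed_convergenceSubmodule {E : Type*} [NormedAddCommGroup E] [NormedSpace ℂ E]
    (φ : ℕ → E →L[ℂ] ℂ) (C : ℝ) (hφ : ∀ n, ‖φ n‖ ≤ C) :
    IsClosed (convergenceSubmodule φ : Set E) := by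
  have hC : 0 ≤ C := (norm_nonneg _).trans (hφ 0)
  refine isClosed_of_closure_subset fun x hx => ?_
  refine cauchySeq_tendsto_of_complete (Metric.cauchySeq_iff'.mpr fun ε hε => ?_)
  obtain ⟨y, ⟨L, hL⟩, hxy⟩ := Metric.mem_closure_iff.mp hx (ε / (3 * (C + 1))) (by positivity)
  obtain ⟨N, hN⟩ := Metric.cauchySeq_iff'.mp hL.cauchySeq (ε / 3) (by positivity)
  have hclose : ∀ n, dist (φ n x) (φ n y) < ε / 3 := fun n => by
    rw [dist_eq_norm, ← map_sub]
    calc ‖φ n (x - y)‖ ≤ (C + 1) * ‖x - y‖ :=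
          (φ n).le_of_opNorm_le ((hφ n).trans (by linarith)) _
      _ < (C + 1) * (ε / (3 * (C + 1))) := by
          rw [← dist_eq_norm]
          gcongr
      _ = ε / 3 := by field_simp
  refine ⟨N, fun n hn => ?_⟩
  have h1 := dist_triangle4 (φ n x) (φ n y) (φ N y) (φ N x)
  have h2 := hclose n
  have h3 := hclose N
  rw [dist_comm] at h3
  linarith [hN n hn]

/-- If the Stieltjes transforms of finite measures with bounded mass converge on a set accumulating
in the upper half-plane, then the integrals of every compactly supported function converge. -/
lemma tendsto_integral_of_tendsto_stieltjesTransform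
    (μ : ℕ → Measure ℝ) [∀ n, IsFiniteMeasure (μ n)] (C : ℝ) (hC : ∀ n, (μ n).real Set.univ ≤ C)
    {S : Set ℂ} (hS : ∀ z ∈ S, 0 < z.im) {z₀ : ℂ} (hz₀ : 0 < z₀.im) (hacc : AccPt z₀ (𝓟 S))
    (hconv : ∀ z ∈ S, ∃ L : ℂ, Tendsto (fun n => stieltjesTransform (μ n) z) atTop (𝓝 L))
    (f : C_c(ℝ, ℝ)) : ∃ L : ℝ, Tendsto (fun n => ∫ x, f x ∂(μ n)) atTop (𝓝 L) := by
  set V := convergenceSubmodule fun n => integralSubInfty (μ n)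
  have hVc : IsClosed (V : Set C(OnePoint ℝ, ℂ)) :=
    isClosed_convergenceSubmodule _ (2 * C) fun n =>
      (norm_integralSubInfty_le (μ n)).trans (by linarith [hC n])
  have hupper : ∀ z : ℂ, 0 < z.im → resolventMap z ∈ V := fun z hz => by
    refine resolventMap_mem_of_accPt V hVc (fun w hw => ?_) hz₀ hacc hz
    obtain ⟨L, hL⟩ := hconv w hw
    exact ⟨L, by simpa only [integralSubInfty_resolventMap _ (hS w hw).ne'] using hL⟩
  have htop : V = ⊤ := by
    refine eq_top_of_resolventMap_mem V hVc ⟨0, by simp [integralSubInfty_one]⟩ fun z hz => ?_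
    rcases lt_or_gt_of_ne hz with hneg | hpos
    · have hz' : 0 < (starRingEnd ℂ z).im := by simpa using hneg
      obtain ⟨L, hL⟩ := hupper _ hz'
      refine ⟨starRingEnd ℂ L, ?_⟩
      have h := (Complex.continuous_conj.tendsto L).comp hL
      simpa only [Function.comp_def, ← integralSubInfty_star, star_resolventMap hz'.ne',
        Complex.conj_conj] using h
    · exact hupper z hpos
  let F : C(OnePoint ℝ, ℂ) := OnePoint.continuousMapMk ⟨fun x => (f x : ℂ), by fun_prop⟩ 0 (by
    have h := (Complex.continuous_ofReal.tendsto 0).comp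
      ((hasCompactSupport_iff_eventuallyEq.mp f.hasCompactSupport).tendsto)
    rwa [Complex.ofReal_zero] at h)
  obtain ⟨L, hL⟩ : F ∈ V := htop ▸ Submodule.mem_top
  refine ⟨L.re, ?_⟩
  have hF : ∀ n, integralSubInfty (μ n) F = ((∫ x, f x ∂(μ n) : ℝ) : ℂ) := fun n => by
    refine (integral_congr_ae (.of_forall fun x => ?_)).trans integral_complex_ofReal
    change (f x : ℂ) - 0 = f x
    exact sub_zero _
  have h := (Complex.continuous_re.tendsto L).comp hL
  simpa only [Function.comp_def, hF, Complex.ofReal_re] using h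

/-- If the integrals of every compactly supported function converge along a sequence of
sub-probability measures, the limits are the integrals against a sub-probability measure. -/
lemma exists_measure_tendsto_integral
    (μ : ℕ → Measure ℝ) [∀ n, IsFiniteMeasure (μ n)] (hsub : ∀ n, μ n Set.univ ≤ 1)
    (h : ∀ f : C_c(ℝ, ℝ), ∃ L : ℝ, Tendsto (fun n => ∫ x, f x ∂(μ n)) atTop (𝓝 L)) :
    ∃ ν : Measure ℝ, ν Set.univ ≤ 1 ∧
      ∀ f : C_c(ℝ, ℝ), Tendsto (fun n => ∫ x, f x ∂(μ n)) atTop (𝓝 (∫ x, f x ∂ν)) := by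
  choose L hL using h
  let Λ₀ : C_c(ℝ, ℝ) →ₗ[ℝ] ℝ :=
    { toFun := L
      map_add' := fun f g => tendsto_nhds_unique (hL (f + g)) (by
        refine ((hL f).add (hL g)).congr fun n => ?_
        exact (integral_add f.integrable g.integrable).symm)
      map_smul' := fun c f => tendsto_nhds_unique (hL (c • f)) (by
        refine ((hL f).const_smul c).congr fun n => ?_
        exact (integral_smul c _).symm) }
  let Λ : C_c(ℝ, ℝ) →ₚ[ℝ] ℝ := PositiveLinearMap.mk₀ Λ₀ fun f hf =>
    ge_of_tendsto' (hL f) fun n => integral_nonneg fun x => hf x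
  refine ⟨RealRMK.rieszMeasure Λ, ?_, fun f => ?_⟩
  · rw [isOpen_univ.measure_eq_iSup_isCompact]
    refine iSup₂_le fun K _ => iSup_le fun hK => ?_
    obtain ⟨f, hfK, -, hfc, hf01⟩ := exists_continuous_one_zero_of_isCompact hK isClosed_empty
      (Set.disjoint_empty K)
    let g : C_c(ℝ, ℝ) := ⟨f, hfc⟩
    refine (RealRMK.rieszMeasure_le_of_eq_one Λ (f := g) (fun x => (hf01 x).1) hK
      fun x hx => hfK hx).trans (ENNReal.ofReal_le_one.mpr ?_)
    refine le_of_tendsto' (hL g) fun n => ?_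
    calc ∫ x, g x ∂(μ n) ≤ ∫ _, (1 : ℝ) ∂(μ n) :=
          integral_mono g.integrable (integrable_const _) fun x => (hf01 x).2
      _ ≤ 1 := by
          simpa [Measure.real] using ENNReal.toReal_mono ENNReal.one_ne_top (hsub n)
  · rw [RealRMK.integral_rieszMeasure]
    exact hL f

section tentFun

variable (m : ℕ) (a b : ℚ)

lemma continuous_tentFun : Continuous (tentFun m a b) := by
  unfold tentFun
  fun_prop

lemma tentFun_nonneg (x : ℝ) : 0 ≤ tentFun m a b x := by
  unfold tentFun
  positivity

lemma tentFun_le_one (x : ℝ) : tentFun m a b x ≤ 1 := by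
  unfold tentFun
  refine mul_le_one₀ (inv_le_one_of_one_le₀ (by simp)) (le_max_left _ _)
    (max_le zero_le_one (min_le_left _ _))

lemma hasCompactSupport_tentFun : HasCompactSupport (tentFun m a b) := by
  refine HasCompactSupport.intro
    (isCompact_Icc (a := (a : ℝ) - ((m : ℝ) + 1)⁻¹) (b := (b : ℝ) + ((m : ℝ) + 1)⁻¹))
    fun x hx => ?_
  have hm : (0 : ℝ) ≤ (m : ℝ) + 1 := by positivity
  unfold tentFun
  refine mul_eq_zero_of_right _ (max_eq_left ((min_le_right _ _).trans ?_))
  rcases not_and_or.mp hx with h | h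
  · exact (min_le_left _ _).trans (mul_nonpos_of_nonneg_of_nonpos hm (by linarith))
  · exact (min_le_right _ _).trans (mul_nonpos_of_nonneg_of_nonpos hm (by linarith))

lemma integral_tentFun_mem_Icc {μ : Measure ℝ} (hμ : μ Set.univ ≤ 1) :
    ∫ x, tentFun m a b x ∂μ ∈ Set.Icc (0 : ℝ) 1 := by
  have : IsFiniteMeasure μ := ⟨hμ.trans_lt ENNReal.one_lt_top⟩
  refine ⟨integral_nonneg (tentFun_nonneg m a b), ?_⟩
  calc ∫ x, tentFun m a b x ∂μ ≤ ∫ _, (1 : ℝ) ∂μ :=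
        integral_mono ((continuous_tentFun m a b).integrable_of_hasCompactSupport
          (hasCompactSupport_tentFun m a b)) (integrable_const _) (tentFun_le_one m a b)
    _ ≤ 1 := by
        simpa [Measure.real] using ENNReal.toReal_mono ENNReal.one_ne_top hμ

end tentFun

/-- Convergence of the integrals of compactly supported functions implies convergence for
`Dmetric`. -/
lemma tendsto_Dmetric (μ : ℕ → Measure ℝ) (hsub : ∀ n, μ n Set.univ ≤ 1) {ν : Measure ℝ}
    (hν : ν Set.univ ≤ 1)
    (h : ∀ f : C_c(ℝ, ℝ), Tendsto (fun n => ∫ x, f x ∂(μ n)) atTop (𝓝 (∫ x, f x ∂ν))) :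
    Tendsto (fun n => Dmetric (μ n) ν) atTop (𝓝 0) := by
  have hsum : Summable fun p : ℕ × ℚ × ℚ => (2 : ℝ) ^ (-(Encodable.encode p : ℤ) - 1) := by
    refine ((summable_geometric_two.comp_injective Encodable.encode_injective).mul_right
      2⁻¹).congr fun p => ?_
    rw [zpow_sub₀ two_ne_zero, zpow_neg, zpow_natCast, zpow_one]
    simp [div_eq_mul_inv]
  have hlim := tendsto_tsum_of_dominated_convergence (𝓕 := atTop)
    (f := fun n (p : ℕ × ℚ × ℚ) =>
      |(∫ x, tentFun p.1 p.2.1 p.2.2 x ∂(μ n)) - ∫ x, tentFun p.1 p.2.1 p.2.2 x ∂ν| *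
      (2 : ℝ) ^ (-(Encodable.encode p : ℤ) - 1)) (g := fun _ => 0) hsum
    (fun p => by
      have hp := h ⟨⟨_, continuous_tentFun p.1 p.2.1 p.2.2⟩, hasCompactSupport_tentFun _ _ _⟩
      simpa using ((hp.sub_const (∫ x, tentFun p.1 p.2.1 p.2.2 x ∂ν)).abs).mul_const ((2 : ℝ) ^ (-(Encodable.encode p : ℤ) - 1)))
    (.of_forall fun n p => by
      have h1 := integral_tentFun_mem_Icc p.1 p.2.1 p.2.2 (hsub n)
      have h2 := integral_tentFun_mem_Icc p.1 p.2.1 p.2.2 hν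
      rw [Real.norm_of_nonneg (by positivity)]
      refine mul_le_of_le_one_left (by positivity) (abs_sub_le_iff.mpr ⟨?_, ?_⟩)
      · linarith [h1.2, h2.1]
      · linarith [h1.1, h2.2])
  simpa [Dmetric] using hlim

/-- If the Stieltjes transforms of a sequence of sub-probability measures
converge pointwise on an infinite set `S ⊂ ℂ⁺` having a cluster point and with imaginary
parts uniformly bounded away from `0`, then the sequence converges vaguely to some
sub-probability measure. -/
theorem vague_limit_of_stieltjes_converges
    (μ : ℕ → Measure ℝ) (hfin : ∀ n, IsFiniteMeasure (μ n))
    (hsub : ∀ n, μ n Set.univ ≤ 1)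
    (S : Set ℂ) (hSinf : S.Infinite)
    (δ : ℝ) (hδ : 0 < δ) (hSim : ∀ z ∈ S, δ ≤ z.im)
    (hScluster : ∃ z₀ : ℂ, AccPt z₀ (Filter.principal S))
    (hconv : ∀ z ∈ S, ∃ L : ℂ, Tendsto (fun n => stieltjesTransform (μ n) z) atTop (𝓝 L)) :
    ∃ ν : Measure ℝ, ν Set.univ ≤ 1 ∧
      Tendsto (fun n => Dmetric (μ n) ν) atTop (𝓝 0) := by
  obtain ⟨z₀, hz₀⟩ := hScluster
  have hz₀im : δ ≤ z₀.im := by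
    have hclosed : IsClosed {z : ℂ | δ ≤ z.im} := isClosed_le continuous_const Complex.continuous_im
    exact closure_minimal hSim hclosed (mem_closure_iff_clusterPt.mpr hz₀.clusterPt)
  have hmass : ∀ n, (μ n).real Set.univ ≤ 1 := fun n => by
    simpa [Measure.real] using ENNReal.toReal_mono ENNReal.one_ne_top (hsub n)
  obtain ⟨ν, hν, hlim⟩ := exists_measure_tendsto_integral μ hsub
    (tendsto_integral_of_tendsto_stieltjesTransform μ 1 hmass (fun z hz => hδ.trans_le (hSim z hz))
      (hδ.trans_le hz₀im) hz₀ hconv)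
  exact ⟨ν, hν, tendsto_Dmetric μ hsub hν hlim⟩
end
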